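/- (Global barrier) Let Ω ⊂ ℝ^d be a bounded domain. There exist a constant ε₆ ∈ (0,1) and a bounded Lipschitz function ψ_g : ℝ^d → ℝ with 1 ≤ ψ_g ≤ 2 on ℝ^d, such that ψ_g is C² on an open set containing Ω̄ and P⁺(D²ψ_g)(x) + P⁺_K(ψ_g)(x) + C₀|Dψ_g(x)| ≤ −ε₆ for every x ∈ Ω. -/

import Mathlib

open MeasureTheory Metric Set
open scoped RealInnerProductSpace ENNReal

noncomputable section

/-- `d`-dimensional Euclidean space. -/
abbrev Ed (d : ℕ) : Type := EuclideanSpace ℝ (Fin d)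

/-- A real-valued function on `ℝ^d` is bounded. -/
def IsBddFun {d : ℕ} (φ : Ed d → ℝ) : Prop := ∃ M, ∀ x, |φ x| ≤ M

/-- The open cube of half side length `δ` centered at `x`. -/
def cubeAt {d : ℕ} (x : Ed d) (δ : ℝ) : Set (Ed d) := {y | ∀ i, |y i - x i| < δ}

/-- The open cube `Q_δ = (-δ, δ)^d`. -/
def cube (d : ℕ) (δ : ℝ) : Set (Ed d) := cubeAt 0 δ

/-- Hessian matrix of `φ` at `x` (matrix of second derivatives). -/
def hess {d : ℕ} (φ : Ed d → ℝ) (x : Ed d) : Matrix (Fin d) (Fin d) ℝ :=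
  Matrix.of fun i j =>
    iteratedFDeriv ℝ 2 φ x ![EuclideanSpace.single i (1 : ℝ), EuclideanSpace.single j (1 : ℝ)]

/-- Symmetric matrices `A` with `λ I ≤ A ≤ Λ I`. -/
def ellipticSet (lam Lam : ℝ) (d : ℕ) : Set (Matrix (Fin d) (Fin d) ℝ) :=
  {A | A.IsSymm ∧ (A - lam • (1 : Matrix (Fin d) (Fin d) ℝ)).PosSemidef ∧
      (Lam • (1 : Matrix (Fin d) (Fin d) ℝ) - A).PosSemidef}

/-- The Pucci maximal operator `P⁺`. -/
def pucciPlus {d : ℕ} (lam Lam : ℝ) (X : Matrix (Fin d) (Fin d) ℝ) : ℝ :=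
  sSup ((fun A => (A * X).trace) '' ellipticSet lam Lam d)

/-- The Pucci minimal operator `P⁻`. -/
def pucciMinus {d : ℕ} (lam Lam : ℝ) (X : Matrix (Fin d) (Fin d) ℝ) : ℝ :=
  sInf ((fun A => (A * X).trace) '' ellipticSet lam Lam d)

/-- The Lévy kernel condition: `K ≥ 0` measurable with `∫ min(|z|²,1) K(z) dz < ∞`. -/
def KernCond {d : ℕ} (K : Ed d → ℝ) : Prop :=
  Measurable K ∧ (∀ z, 0 ≤ K z) ∧ Integrable (fun z : Ed d => min (‖z‖ ^ 2) 1 * K z)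

/-- The rescaled kernel `K_r(z) = r^{d+2} K(rz)`. -/
def Kresc {d : ℕ} (K : Ed d → ℝ) (r : ℝ) (z : Ed d) : ℝ := r ^ (d + 2) * K (r • z)

/-- The second-order increment `u(x+z) − u(x) − 1_{B_{1/r}}(z) Du(x)·z`. -/
def deltaOp {d : ℕ} (φ : Ed d → ℝ) (r : ℝ) (x z : Ed d) : ℝ :=
  φ (x + z) - φ x - (Metric.ball (0 : Ed d) (1 / r)).indicator (fun w => ⟪gradient φ x, w⟫) z

/-- The maximal nonlocal Pucci operator `P⁺_{K,r}`. -/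
def nlPlus {d : ℕ} (K : Ed d → ℝ) (r : ℝ) (φ : Ed d → ℝ) (x : Ed d) : ℝ :=
  ∫ z, max (deltaOp φ r x z) 0 * Kresc K r z

/-- The minimal nonlocal Pucci operator `P⁻_{K,r}`. -/
def nlMinus {d : ℕ} (K : Ed d → ℝ) (r : ℝ) (φ : Ed d → ℝ) (x : Ed d) : ℝ :=
  -∫ z, max (-deltaOp φ r x z) 0 * Kresc K r z

/-- Viscosity supersolution of `−P⁻(D²u) − P⁻_{K,r}(u) + C₀ r |Du| ≥ f` in `O`. -/
def SupersolExtremal {d : ℕ} (lam Lam C0 r : ℝ) (K f : Ed d → ℝ) (O : Set (Ed d))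
    (u : Ed d → ℝ) : Prop :=
  ∀ φ : Ed d → ℝ, ContDiff ℝ 2 φ → IsBddFun φ → ∀ x ∈ O, (∀ y, φ y ≤ u y) → u x = φ x →
    f x ≤ -pucciMinus lam Lam (hess φ x) - nlMinus K r φ x + C0 * r * ‖gradient φ x‖

/-- Viscosity subsolution of `P⁺(D²u) + P⁺_K(u) + C₀|Du| ≥ g` in `O`. -/
def SubsolPlus {d : ℕ} (lam Lam C0 : ℝ) (K g : Ed d → ℝ) (O : Set (Ed d)) (u : Ed d → ℝ) : Prop :=
  ∀ φ : Ed d → ℝ, ContDiff ℝ 2 φ → IsBddFun φ → ∀ x ∈ O, (∀ y, u y ≤ φ y) → u x = φ x →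
    g x ≤ pucciPlus lam Lam (hess φ x) + nlPlus K 1 φ x + C0 * ‖gradient φ x‖

/-- Viscosity supersolution of `P⁻(D²u) + P⁻_K(u) − C₀|Du| ≤ g` in `O`. -/
def SupersolMinus {d : ℕ} (lam Lam C0 : ℝ) (K g : Ed d → ℝ) (O : Set (Ed d)) (u : Ed d → ℝ) : Prop :=
  ∀ φ : Ed d → ℝ, ContDiff ℝ 2 φ → IsBddFun φ → ∀ x ∈ O, (∀ y, φ y ≤ u y) → u x = φ x →
    pucciMinus lam Lam (hess φ x) + nlMinus K 1 φ x - C0 * ‖gradient φ x‖ ≤ g x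

/-- Negative part `f⁻ = −min{f,0}`. -/
def nPart {d : ℕ} (f : Ed d → ℝ) : Ed d → ℝ := fun x => max (-f x) 0

/-- Positive part `f⁺ = max{f,0}`. -/
def pPart {d : ℕ} (f : Ed d → ℝ) : Ed d → ℝ := fun x => max (f x) 0

/-- The `L^p` norm of `f` on a set `S`. -/
def LnormOn {d : ℕ} (p : ℝ) (S : Set (Ed d)) (f : Ed d → ℝ) : ℝ :=
  (∫ x in S, |f x| ^ p) ^ (1 / p)

/-- The nonlocal contact set `Γ^{n,−}_O(v)`. -/
def nContact {d : ℕ} (O : Set (Ed d)) (v : Ed d → ℝ) : Set (Ed d) :=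
  {x | x ∈ O ∧ v x < sInf (v '' Oᶜ) ∧
      ∃ p : Ed d, ∀ y, Metric.infDist y O < Metric.diam O → v x + ⟪p, y - x⟫ ≤ v y}

/-- The set `G^u_M` of points where `u` is touched from below by a paraboloid of opening `M`. -/
def GSet {d : ℕ} (u : Ed d → ℝ) (M : ℝ) : Set (Ed d) :=
  {x | ∃ ρ > 0, ∃ A C : ℝ, ∃ B : Ed d, |A| + ‖B‖ + |C| ≤ M ∧ u x = A ∧
      ∀ y ∈ Metric.ball x ρ, A + ⟪B, y - x⟫ - C / 2 * ‖y - x‖ ^ 2 ≤ u y}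

/-- The bad set `B^u_M`. -/
def BSet {d : ℕ} (u : Ed d → ℝ) (M : ℝ) : Set (Ed d) := (GSet u M)ᶜ

/-- Upper semicontinuous envelope `u*`. -/
def usEnv {d : ℕ} (u : Ed d → ℝ) (x : Ed d) : ℝ :=
  ⨅ ρ : {ρ : ℝ // 0 < ρ}, ⨆ y : {y : Ed d // ‖y - x‖ ≤ ρ.1}, u y.1

/-- Lower semicontinuous envelope `u_*`. -/
def lsEnv {d : ℕ} (u : Ed d → ℝ) (x : Ed d) : ℝ :=
  ⨆ ρ : {ρ : ℝ // 0 < ρ}, ⨅ y : {y : Ed d // ‖y - x‖ ≤ ρ.1}, u y.1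

/-- A modulus of continuity. -/
def IsModulus (m : ℝ → ℝ) : Prop :=
  (∀ t, 0 ≤ m t) ∧ Monotone m ∧ m 0 = 0 ∧ ContinuousAt m 0

/-- The uniform exterior ball condition. -/
def ExtBallCond {d : ℕ} (Ω : Set (Ed d)) : Prop :=
  ∃ ρ > 0, ∀ ξ ∈ frontier Ω, ∃ y ∈ Ωᶜ, Metric.ball y ρ ⊆ Ωᶜ ∧ ξ ∈ Metric.sphere y ρ

section HJBI

variable {d : ℕ} {𝒜 ℬ : Type}

/-- The linear nonlocal operator `I_{ab}[x, φ]`. -/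
def Iop (N : 𝒜 → ℬ → Ed d → Ed d → ℝ) (a : 𝒜) (b : ℬ) (φ : Ed d → ℝ) (x : Ed d) : ℝ :=
  ∫ z, (φ (x + z) - φ x -
      (Metric.ball (0 : Ed d) 1).indicator (fun w => ⟪gradient φ x, w⟫) z) * N a b x z

/-- The HJBI operator evaluated at `φ`, with the zeroth order slot evaluated at `s`. -/
def HJBIat (aM : 𝒜 → ℬ → Ed d → Matrix (Fin d) (Fin d) ℝ) (bV : 𝒜 → ℬ → Ed d → Ed d)
    (cF fF : 𝒜 → ℬ → Ed d → ℝ) (N : 𝒜 → ℬ → Ed d → Ed d → ℝ)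
    (φ : Ed d → ℝ) (s : ℝ) (x : Ed d) : ℝ :=
  ⨆ a, ⨅ b, (-(aM a b x * hess φ x).trace - Iop N a b φ x +
    ⟪bV a b x, gradient φ x⟫ + cF a b x * s + fF a b x)

/-- The HJBI operator `ℐφ(x)`. -/
def HJBIop (aM : 𝒜 → ℬ → Ed d → Matrix (Fin d) (Fin d) ℝ) (bV : 𝒜 → ℬ → Ed d → Ed d)
    (cF fF : 𝒜 → ℬ → Ed d → ℝ) (N : 𝒜 → ℬ → Ed d → Ed d → ℝ)
    (φ : Ed d → ℝ) (x : Ed d) : ℝ :=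
  HJBIat aM bV cF fF N φ (φ x) x

/-- Viscosity subsolution of `ℐu = 0` in `Ω` (test function formulation). -/
def SubsolHJBI (aM : 𝒜 → ℬ → Ed d → Matrix (Fin d) (Fin d) ℝ) (bV : 𝒜 → ℬ → Ed d → Ed d)
    (cF fF : 𝒜 → ℬ → Ed d → ℝ) (N : 𝒜 → ℬ → Ed d → Ed d → ℝ) (Ω : Set (Ed d))
    (u : Ed d → ℝ) : Prop :=
  ∀ φ : Ed d → ℝ, ContDiff ℝ 2 φ → IsBddFun φ → ∀ x ∈ Ω, (∀ y, u y ≤ φ y) → u x = φ x →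
    HJBIop aM bV cF fF N φ x ≤ 0

/-- Viscosity supersolution of `ℐu = 0` in `Ω` (test function formulation). -/
def SupersolHJBI (aM : 𝒜 → ℬ → Ed d → Matrix (Fin d) (Fin d) ℝ) (bV : 𝒜 → ℬ → Ed d → Ed d)
    (cF fF : 𝒜 → ℬ → Ed d → ℝ) (N : 𝒜 → ℬ → Ed d → Ed d → ℝ) (Ω : Set (Ed d))
    (u : Ed d → ℝ) : Prop :=
  ∀ φ : Ed d → ℝ, ContDiff ℝ 2 φ → IsBddFun φ → ∀ x ∈ Ω, (∀ y, φ y ≤ u y) → u x = φ x →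
    0 ≤ HJBIop aM bV cF fF N φ x

/-- Uniform ellipticity of the HJBI operator `ℐ`. -/
def UnifElliptic (lam Lam C0 : ℝ) (K : Ed d → ℝ) (Ω : Set (Ed d))
    (aM : 𝒜 → ℬ → Ed d → Matrix (Fin d) (Fin d) ℝ) (bV : 𝒜 → ℬ → Ed d → Ed d)
    (cF fF : 𝒜 → ℬ → Ed d → ℝ) (N : 𝒜 → ℬ → Ed d → Ed d → ℝ) : Prop :=
  ∃ m : ℝ → ℝ, IsModulus m ∧
    ∀ r s : ℝ, ∀ x ∈ Ω, ∀ φ ψ : Ed d → ℝ,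
      ContDiff ℝ 2 φ → IsBddFun φ → ContDiff ℝ 2 ψ → IsBddFun ψ →
      (pucciMinus lam Lam (hess (fun y => φ y - ψ y) x) + nlMinus K 1 (fun y => φ y - ψ y) x -
          C0 * ‖gradient (fun y => ψ y - φ y) x‖ - m |r - s| ≤
        HJBIat aM bV cF fF N ψ r x - HJBIat aM bV cF fF N φ s x) ∧
      (HJBIat aM bV cF fF N ψ r x - HJBIat aM bV cF fF N φ s x ≤
        pucciPlus lam Lam (hess (fun y => φ y - ψ y) x) + nlPlus K 1 (fun y => φ y - ψ y) x +
          C0 * ‖gradient (fun y => ψ y - φ y) x‖ + m |r - s|)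

/-- Boundedness of the coefficient families, uniformly in `a, b`. -/
def FamiliesBdd (Ω : Set (Ed d)) (aM : 𝒜 → ℬ → Ed d → Matrix (Fin d) (Fin d) ℝ)
    (bV : 𝒜 → ℬ → Ed d → Ed d) (cF fF : 𝒜 → ℬ → Ed d → ℝ) : Prop :=
  ∃ Cb : ℝ, ∀ a b, ∀ x ∈ Ω, (∀ i j, |aM a b x i j| ≤ Cb) ∧ ‖bV a b x‖ ≤ Cb ∧
      |cF a b x| ≤ Cb ∧ |fF a b x| ≤ Cb

/-- Uniform continuity of the coefficient families with a common modulus, uniformly in `a, b, z`. -/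
def FamiliesUC (Ω : Set (Ed d)) (aM : 𝒜 → ℬ → Ed d → Matrix (Fin d) (Fin d) ℝ)
    (bV : 𝒜 → ℬ → Ed d → Ed d) (cF fF : 𝒜 → ℬ → Ed d → ℝ)
    (N : 𝒜 → ℬ → Ed d → Ed d → ℝ) : Prop :=
  ∃ m₀ : ℝ → ℝ, IsModulus m₀ ∧ ∀ a b, ∀ x ∈ Ω, ∀ y ∈ Ω,
      (∀ i j, |aM a b x i j - aM a b y i j| ≤ m₀ ‖x - y‖) ∧
      ‖bV a b x - bV a b y‖ ≤ m₀ ‖x - y‖ ∧ |cF a b x - cF a b y| ≤ m₀ ‖x - y‖ ∧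
      |fF a b x - fF a b y| ≤ m₀ ‖x - y‖ ∧ ∀ z, |N a b x z - N a b y z| ≤ m₀ ‖x - y‖

end HJBI
theorem gb_exp_lip (a b : ℝ) (ha : 0 ≤ a) (hb : 0 ≤ b) :
    |Real.exp (-a) - Real.exp (-b)| ≤ |a - b| := by
  wlog h : a ≤ b generalizing a b
  · rw [abs_sub_comm, abs_sub_comm a b]
    exact this b a hb ha (le_of_not_ge h)
  have h1 : Real.exp (-b) ≤ Real.exp (-a) := Real.exp_le_exp.2 (by linarith)
  rw [abs_of_nonneg (by linarith), abs_of_nonpos (by linarith)]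
  have h2 : Real.exp (-b) = Real.exp (-a) * Real.exp (-(b - a)) := by
    rw [← Real.exp_add]; congr 1; ring
  have h3 : Real.exp (-a) ≤ 1 := Real.exp_le_one_iff.2 (by linarith)
  have h4 := Real.add_one_le_exp (-(b - a))
  have h5 := Real.exp_pos (-a)
  rw [h2]
  nlinarith

/-- The smooth function which the barrier agrees with on a half space. -/
def gbG {d : ℕ} (i : Fin d) (g T : ℝ) (x : Ed d) : ℝ := 2 - Real.exp (-g * (x i + T))

/-- The barrier. -/
def gbPsi {d : ℕ} (i : Fin d) (g T : ℝ) (x : Ed d) : ℝ :=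
  2 - Real.exp (-(g * max (x i + T) 0))

theorem gb_exp_deriv {d : ℕ} (i : Fin d) (g T : ℝ) (x : Ed d) :
    HasFDerivAt (fun y : Ed d => Real.exp (-g * (y i + T)))
      ((-g * Real.exp (-g * (x i + T))) • (EuclideanSpace.proj i : Ed d →L[ℝ] ℝ)) x := by
  have h : HasFDerivAt (fun y : Ed d => y i) (EuclideanSpace.proj i : Ed d →L[ℝ] ℝ) x :=
    (EuclideanSpace.proj i : Ed d →L[ℝ] ℝ).hasFDerivAt
  have h2 := ((h.add_const T).const_mul (-g)).exp
  refine h2.congr_fderiv ?_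
  rw [smul_smul, mul_comm]

theorem gb_fderiv {d : ℕ} (i : Fin d) (g T : ℝ) (x : Ed d) :
    fderiv ℝ (gbG i g T) x =
      (g * Real.exp (-g * (x i + T))) • (EuclideanSpace.proj i : Ed d →L[ℝ] ℝ) := by
  have h := (gb_exp_deriv i g T x).const_sub 2
  have h2 : HasFDerivAt (gbG i g T) _ x := h
  rw [h2.fderiv, ← neg_smul]
  congr 1; ring

theorem gb_hess {d : ℕ} (i : Fin d) (g T : ℝ) (x : Ed d) (v w : Ed d) :
    iteratedFDeriv ℝ 2 (gbG i g T) x ![v, w] =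
      -(g ^ 2 * Real.exp (-g * (x i + T))) * (v i * w i) := by
  rw [iteratedFDeriv_two_apply]
  have h0 : fderiv ℝ (gbG i g T) = fun y => (g * Real.exp (-g * (y i + T))) •
      (EuclideanSpace.proj i : Ed d →L[ℝ] ℝ) := funext (gb_fderiv i g T)
  have h1 := ((gb_exp_deriv i g T x).const_mul g).smul_const
    (EuclideanSpace.proj i : Ed d →L[ℝ] ℝ)
  rw [h0, h1.fderiv]
  simp
  ring

theorem gb_eventuallyEq {d : ℕ} (i : Fin d) (g T : ℝ) (x : Ed d) (hx : 0 < x i + T) :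
    gbPsi i g T =ᶠ[nhds x] gbG i g T := by
  have ho : IsOpen {y : Ed d | 0 < y i + T} :=
    isOpen_lt continuous_const (by fun_prop)
  filter_upwards [ho.mem_nhds hx] with y hy
  have hy' : 0 < y i + T := hy
  simp only [gbPsi, gbG, max_eq_left hy'.le, neg_mul]

theorem gb_pucci {d : ℕ} (i : Fin d) (lam Lam c : ℝ) (hLam : lam ≤ Lam) (hc : 0 ≤ c)
    (X : Matrix (Fin d) (Fin d) ℝ)
    (hX : ∀ j k, X j k = -c * ((if i = j then 1 else 0) * (if i = k then 1 else 0))) :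
    pucciPlus lam Lam X ≤ -c * lam := by
  apply csSup_le
  · refine Set.Nonempty.image _ ⟨lam • 1, ?_, ?_, ?_⟩
    · exact (Matrix.isSymm_one).smul lam
    · rw [sub_self]; exact Matrix.PosSemidef.zero
    · rw [← sub_smul]
      exact Matrix.PosSemidef.one.smul (sub_nonneg.2 hLam)
  · rintro _ ⟨A, ⟨-, hA, -⟩, rfl⟩
    have h := hA.diag_nonneg (i := i)
    simp at h
    have : (A * X).trace = -c * A i i := by
      simp [Matrix.trace, Matrix.mul_apply, hX, mul_comm]
    simp only [this]
    nlinarith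

theorem gb_proj_norm {d : ℕ} (i : Fin d) : ‖(EuclideanSpace.proj i : Ed d →L[ℝ] ℝ)‖ ≤ 1 := by
  refine ContinuousLinearMap.opNorm_le_bound _ zero_le_one fun x => ?_
  rw [one_mul]
  exact PiLp.norm_apply_le x i

theorem gb_nl {d : ℕ} (i : Fin d) (g T : ℝ) (hg : 0 ≤ g) (K : Ed d → ℝ) (hK : KernCond K)
    (x : Ed d) (hx : 1 < x i + T) :
    nlPlus K 1 (gbPsi i g T) x ≤
      Real.exp (-g * (x i + T)) * ∫ z : Ed d, min (‖z‖ ^ 2) 1 * K z := by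
  obtain ⟨-, hK0, hKi⟩ := hK
  have hE := Real.exp_pos (-g * (x i + T))
  have hpx : gbPsi i g T x = 2 - Real.exp (-g * (x i + T)) :=
    (gb_eventuallyEq i g T x (by linarith)).eq_of_nhds
  unfold nlPlus
  rw [← integral_const_mul]
  refine integral_mono_of_nonneg (Filter.Eventually.of_forall fun z => ?_) (hKi.const_mul _)
    (Filter.Eventually.of_forall fun z => ?_)
  · simp only [Kresc, one_pow, one_mul, one_smul]
    exact mul_nonneg (le_max_right _ _) (hK0 z)
  · simp only [Kresc, one_pow, one_mul, one_smul]
    rw [← mul_assoc]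
    refine mul_le_mul_of_nonneg_right ?_ (hK0 z)
    have hz0 : 0 ≤ Real.exp (-g * (x i + T)) * min (‖z‖ ^ 2) 1 := by positivity
    refine max_le ?_ hz0
    unfold deltaOp
    rw [hpx]
    by_cases hz : z ∈ ball (0 : Ed d) (1 / 1)
    · rw [Set.indicator_of_mem hz]
      refine le_trans ?_ hz0
      have hz1 : ‖z‖ < 1 := by simpa using hz
      have hzi : |z i| < 1 := lt_of_le_of_lt (PiLp.norm_apply_le z i) hz1
      have hzi' := (abs_lt.1 hzi).1
      have hxz : 0 < (x + z) i + T := by simp; linarith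
      rw [(gb_eventuallyEq i g T (x + z) hxz).eq_of_nhds]
      have hgr : ⟪gradient (gbPsi i g T) x, z⟫ = g * Real.exp (-g * (x i + T)) * z i := by
        rw [gradient, InnerProductSpace.toDual_symm_apply,
          (gb_eventuallyEq i g T x (by linarith)).fderiv_eq, gb_fderiv]
        simp
      rw [hgr, gbG]
      have h2 : Real.exp (-g * ((x + z) i + T)) =
          Real.exp (-g * (x i + T)) * Real.exp (-(g * z i)) := by
        rw [← Real.exp_add]; congr 1; simp; ring
      rw [h2]
      have h3 := Real.add_one_le_exp (-(g * z i))
      nlinarith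
    · rw [Set.indicator_of_notMem hz]
      have hz1 : 1 ≤ ‖z‖ := by simpa using hz
      rw [min_eq_right (by nlinarith)]
      have := Real.exp_pos (-(g * max ((x + z) i + T) 0))
      simp only [gbPsi]
      linarith

/-- the global barrier (Lemma 5.5). -/
theorem global_barrier {d : ℕ} (hd : 1 ≤ d) (lam Lam C0 : ℝ)
    (hlam : 0 < lam) (hLam : lam ≤ Lam) (hC0 : 0 ≤ C0)
    (K : Ed d → ℝ) (hK : KernCond K)
    (Ω : Set (Ed d)) (hΩo : IsOpen Ω) (hΩconn : IsConnected Ω)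
    (hΩb : Bornology.IsBounded Ω) :
    ∃ ε₆ ∈ Ioo (0 : ℝ) 1, ∃ ψ : Ed d → ℝ, IsBddFun ψ ∧
      (∃ L : NNReal, LipschitzWith L ψ) ∧
      (∀ x, ψ x ∈ Icc (1 : ℝ) 2) ∧
      (∃ U : Set (Ed d), IsOpen U ∧ closure Ω ⊆ U ∧ ContDiffOn ℝ 2 ψ U) ∧
      ∀ x ∈ Ω, pucciPlus lam Lam (hess ψ x) + nlPlus K 1 ψ x + C0 * ‖gradient ψ x‖ ≤ -ε₆ := by
  obtain ⟨R, hR0, hR⟩ := hΩb.subset_closedBall_lt 0 (0 : Ed d)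
  set i : Fin d := ⟨0, hd⟩
  set M : ℝ := ∫ z : Ed d, min (‖z‖ ^ 2) 1 * K z with hM
  have hM0 : 0 ≤ M := integral_nonneg fun z => mul_nonneg (by positivity) (hK.2.1 z)
  obtain ⟨g, hg0, hg⟩ : ∃ g : ℝ, 0 < g ∧ -(lam * g ^ 2) + M + C0 * g ≤ -1 := by
    refine ⟨1 + (C0 + M + 1) / lam, by positivity, ?_⟩
    have h1 : lam * ((C0 + M + 1) / lam) = C0 + M + 1 := by field_simp
    have h2 : 0 ≤ (C0 + M + 1) / lam := by positivity
    set q := (C0 + M + 1) / lam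
    have h3 : lam * (1 + q) ^ 2 = (lam + (C0 + M + 1)) * (1 + q) := by rw [← h1]; ring
    rw [h3]
    nlinarith [mul_nonneg hlam.le h2, mul_nonneg hM0 h2]
  have hcoord : ∀ x : Ed d, ‖x‖ ≤ R → |x i| ≤ R := fun x hx =>
    le_trans (PiLp.norm_apply_le x i) hx
  refine ⟨Real.exp (-(g * (2 * R + 2))), ⟨Real.exp_pos _, ?_⟩, gbPsi i g (R + 2), ?_⟩
  · rw [Real.exp_lt_one_iff, neg_lt_zero]; positivity
  have hIcc : ∀ x, gbPsi i g (R + 2) x ∈ Icc (1 : ℝ) 2 := by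
    intro x
    have h1 := Real.exp_pos (-(g * max (x i + (R + 2)) 0))
    have h2 : Real.exp (-(g * max (x i + (R + 2)) 0)) ≤ 1 := by
      rw [Real.exp_le_one_iff, neg_nonpos]
      exact mul_nonneg hg0.le (le_max_right _ _)
    constructor <;> simp only [gbPsi] <;> linarith
  refine ⟨⟨2, fun x => ?_⟩, ⟨g.toNNReal, ?_⟩, hIcc,
    ⟨{y : Ed d | 0 < y i + (R + 2)}, isOpen_lt continuous_const (by fun_prop), ?_, ?_⟩, ?_⟩
  · have := hIcc x
    rw [abs_le]; constructor <;> linarith [this.1, this.2]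
  · refine LipschitzWith.of_dist_le_mul fun x y => ?_
    rw [Real.coe_toNNReal _ hg0.le, Real.dist_eq, dist_eq_norm]
    have h1 := gb_exp_lip (g * max (y i + (R + 2)) 0) (g * max (x i + (R + 2)) 0)
      (mul_nonneg hg0.le (le_max_right _ _)) (mul_nonneg hg0.le (le_max_right _ _))
    have h2 : gbPsi i g (R + 2) x - gbPsi i g (R + 2) y =
        Real.exp (-(g * max (y i + (R + 2)) 0)) - Real.exp (-(g * max (x i + (R + 2)) 0)) := by
      simp only [gbPsi]; ring
    rw [h2]
    refine h1.trans ?_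
    rw [← mul_sub, abs_mul, abs_of_pos hg0]
    refine mul_le_mul_of_nonneg_left ?_ hg0.le
    refine (abs_max_sub_max_le_abs _ _ _).trans ?_
    rw [abs_sub_comm]
    have h3 : x i + (R + 2) - (y i + (R + 2)) = (x - y) i := by simp
    rw [h3]
    exact PiLp.norm_apply_le (x - y) i
  · intro x hx
    have h1 := closure_minimal hR isClosed_closedBall hx
    have h2 := (abs_le.1 (hcoord x (by simpa using h1))).1
    show 0 < x i + (R + 2)
    linarith
  · have hG : ContDiff ℝ 2 (gbG i g (R + 2)) := by
      unfold gbG; fun_prop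
    refine hG.contDiffOn.congr fun y hy => ?_
    exact (gb_eventuallyEq i g (R + 2) y hy).eq_of_nhds
  · intro x hx
    have h1 := hcoord x (by simpa using hR hx)
    obtain ⟨h2, h3⟩ := abs_le.1 h1
    have hev := gb_eventuallyEq i g (R + 2) x (by linarith)
    have hnl := gb_nl i g (R + 2) hg0.le K hK x (by linarith)
    rw [← hM] at hnl
    set E := Real.exp (-g * (x i + (R + 2))) with hEdef
    have hE : 0 < E := Real.exp_pos _
    have hEl : Real.exp (-(g * (2 * R + 2))) ≤ E := by
      rw [hEdef]; apply Real.exp_le_exp.2; nlinarith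
    have hp : pucciPlus lam Lam (hess (gbPsi i g (R + 2)) x) ≤ -(g ^ 2 * E) * lam := by
      refine gb_pucci i lam Lam _ hLam (by positivity) _ fun j k => ?_
      simp only [hess, Matrix.of_apply]
      rw [(hev.iteratedFDeriv ℝ 2).eq_of_nhds, gb_hess]
      simp [hEdef, Pi.single_apply]
    have hgr : ‖gradient (gbPsi i g (R + 2)) x‖ ≤ g * E := by
      rw [gradient, LinearIsometryEquiv.norm_map, hev.fderiv_eq, gb_fderiv, norm_smul,
        Real.norm_of_nonneg (by positivity)]
      exact mul_le_of_le_one_right (by positivity) (gb_proj_norm i)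
    have hgr' := mul_le_mul_of_nonneg_left hgr hC0
    have := mul_le_mul_of_nonneg_left hg hE.le
    nlinarith
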